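/- Let (G,q) be a nondegenerate metric group and let L₁ and L₂ be subgroups of G that are maximal among isotropic subgroups of G (with respect to inclusion). Then there exists a group isomorphism φ : L₁^⊥/L₁ → L₂^⊥/L₂ such that q̄₂(φ(x)) = q̄₁(x) for all x ∈ L₁^⊥/L₁, where q̄ᵢ denotes the quadratic form induced by q on Lᵢ^⊥/Lᵢ. In other words, the metric groups (L₁^⊥/L₁, q̄₁) and (L₂^⊥/L₂, q̄₂) are isomorphic. -/

import Mathlib

/-- The bimultiplicative form associated to a quadratic form `q` on a group:
`b(g,h) = q(g*h) * q(g)⁻¹ * q(h)⁻¹`. -/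
def metricForm {G : Type*} [Group G] (q : G → ℂˣ) (g h : G) : ℂˣ :=
  q (g * h) * (q g)⁻¹ * (q h)⁻¹

section MetricGroup

variable {G : Type*} [CommGroup G] {q : G → ℂˣ}

theorem metricForm_comm (q : G → ℂˣ) (g h : G) : metricForm q g h = metricForm q h g := by
  simp only [metricForm, mul_comm g h, mul_right_comm]

theorem map_mul_eq_of_metricForm_eq_one {g h : G} (hgh : metricForm q g h = 1) :
    q (g * h) = q g * q h := by
  rwa [metricForm, mul_inv_eq_one, mul_inv_eq_iff_eq_mul, mul_comm (q h)] at hgh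

/-- The bimultiplicative form of a quadratic form, bundled as a homomorphism to the dual group. -/
def metricFormHom (q : G → ℂˣ)
    (hq : ∀ g₁ g₂ h : G, metricForm q (g₁ * g₂) h = metricForm q g₁ h * metricForm q g₂ h) :
    G →* G →* ℂˣ :=
  MonoidHom.mk' (fun k => MonoidHom.mk' (fun g => metricForm q g k) fun g₁ g₂ => hq g₁ g₂ k)
    fun k₁ k₂ => by
      ext1 g
      simp only [MonoidHom.mk'_apply, MonoidHom.mul_apply, metricForm_comm q g, hq]

@[simp]
theorem metricFormHom_apply
    (hq : ∀ g₁ g₂ h : G, metricForm q (g₁ * g₂) h = metricForm q g₁ h * metricForm q g₂ h)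
    (k g : G) : metricFormHom q hq k g = metricForm q g k :=
  rfl

/-- Every character of a finite nondegenerate metric group is represented by the form. -/
theorem metricFormHom_surjective [Finite G]
    (hq : ∀ g₁ g₂ h : G, metricForm q (g₁ * g₂) h = metricForm q g₁ h * metricForm q g₂ h)
    (hnd : ∀ g : G, (∀ h : G, metricForm q g h = 1) → g = 1) :
    Function.Surjective (metricFormHom q hq) := by
  have hinj : Function.Injective (metricFormHom q hq) := by
    refine (injective_iff_map_eq_one _).2 fun k hk => hnd k fun h => ?_
    rw [metricForm_comm]
    exact DFunLike.congr_fun hk h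
  have hcard : Nat.card (G →* ℂˣ) = Nat.card G :=
    CommGroup.card_monoidHom_of_hasEnoughRootsOfUnity G ℂ
  have : Finite (G →* ℂˣ) := Nat.finite_of_card_ne_zero (hcard ▸ Nat.card_pos.ne')
  exact ((Nat.bijective_iff_injective_and_card _).2 ⟨hinj, hcard.symm⟩).2

/-- In a finite nondegenerate metric group, every subgroup contains its double orthogonal. -/
theorem mem_of_forall_orthogonal [Finite G]
    (hq : ∀ g₁ g₂ h : G, metricForm q (g₁ * g₂) h = metricForm q g₁ h * metricForm q g₂ h)
    (hnd : ∀ g : G, (∀ h : G, metricForm q g h = 1) → g = 1) (H : Subgroup G) {g : G}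
    (hg : ∀ k : G, (∀ h ∈ H, metricForm q h k = 1) → metricForm q g k = 1) : g ∈ H := by
  by_contra hgH
  have hne : (g : G ⧸ H) ≠ 1 := fun h => hgH ((QuotientGroup.eq_one_iff g).1 h)
  obtain ⟨χ, hχ⟩ := CommGroup.exists_apply_ne_one_of_hasEnoughRootsOfUnity (G ⧸ H) ℂ hne
  obtain ⟨k, hk⟩ := metricFormHom_surjective hq hnd (χ.comp (QuotientGroup.mk' H))
  have hk' (x : G) : metricForm q x k = χ (x : G ⧸ H) := DFunLike.congr_fun hk x
  refine hχ ((hk' g).symm.trans (hg k fun h hh => ?_))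
  rw [hk', (QuotientGroup.eq_one_iff h).2 hh, map_one]

theorem map_pow_eq_one_of_map_eq_one
    (hq1 : ∀ g : G, q g⁻¹ = q g)
    (hq2 : ∀ g₁ g₂ h : G, metricForm q (g₁ * g₂) h = metricForm q g₁ h * metricForm q g₂ h)
    (hone : q 1 = 1) {x : G} (hx : q x = 1) (n : ℕ) : q (x ^ n) = 1 := by
  have hinv : metricForm q x⁻¹ x = 1 := by simp [metricForm, hq1, hx, hone]
  have hself : metricForm q x x = 1 := by
    have h := map_inv (metricFormHom q hq2 x) x
    rw [metricFormHom_apply, metricFormHom_apply, hinv] at h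
    exact inv_eq_one.1 h.symm
  induction n with
  | zero => simpa using hone
  | succ n ih =>
    have h : metricForm q (x ^ n) x = 1 := by
      rw [← metricFormHom_apply hq2, map_pow, metricFormHom_apply, hself, one_pow]
    rw [pow_succ, map_mul_eq_of_metricForm_eq_one h, ih, hx, one_mul]

/-- A maximal isotropic subgroup contains every isotropic element orthogonal to it. -/
theorem mem_of_maximal_isotropic [Finite G]
    (hq1 : ∀ g : G, q g⁻¹ = q g)
    (hq2 : ∀ g₁ g₂ h : G, metricForm q (g₁ * g₂) h = metricForm q g₁ h * metricForm q g₂ h)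
    {L : Subgroup G} (hiso : ∀ h ∈ L, q h = 1)
    (hmax : ∀ M : Subgroup G, (∀ h ∈ M, q h = 1) → L ≤ M → M = L) {x : G}
    (hxL : ∀ h ∈ L, metricForm q x h = 1) (hx : q x = 1) : x ∈ L := by
  rw [← hmax (L ⊔ Subgroup.zpowers x) _ le_sup_left]
  · exact Subgroup.mem_sup_right (Subgroup.mem_zpowers x)
  intro g hg
  obtain ⟨l, hl, y, hy, rfl⟩ := Subgroup.mem_sup.1 hg
  obtain ⟨n, rfl⟩ := Submonoid.mem_powers_iff _ _ |>.1 (mem_powers_iff_mem_zpowers.2 hy)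
  have h : metricForm q l (x ^ n) = 1 := by
    rw [metricForm_comm, ← metricFormHom_apply hq2, map_pow, metricFormHom_apply, hxL l hl, one_pow]
  rw [map_mul_eq_of_metricForm_eq_one h, hiso l hl,
    map_pow_eq_one_of_map_eq_one hq1 hq2 (hiso 1 L.one_mem) hx, one_mul]

/-- If `L₁` is maximal isotropic and `L₂` isotropic, then `L₁` together with the common orthogonal
complement of `L₁` and `L₂` generates the orthogonal complement of `L₁`. -/
theorem orthogonal_le_sup_inf_orthogonal [Finite G]
    (hq1 : ∀ g : G, q g⁻¹ = q g)
    (hq2 : ∀ g₁ g₂ h : G, metricForm q (g₁ * g₂) h = metricForm q g₁ h * metricForm q g₂ h)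
    (hnd : ∀ g : G, (∀ h : G, metricForm q g h = 1) → g = 1)
    {L₁ L₂ P₁ P₂ : Subgroup G}
    (hiso₁ : ∀ h ∈ L₁, q h = 1) (hiso₂ : ∀ h ∈ L₂, q h = 1)
    (hmax₁ : ∀ L : Subgroup G, (∀ h ∈ L, q h = 1) → L₁ ≤ L → L = L₁)
    (hP₁ : ∀ g, g ∈ P₁ ↔ ∀ h ∈ L₁, metricForm q g h = 1)
    (hP₂ : ∀ g, g ∈ P₂ ↔ ∀ h ∈ L₂, metricForm q g h = 1) :
    P₁ ≤ L₁ ⊔ P₁ ⊓ P₂ := by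
  intro g hg
  refine mem_of_forall_orthogonal hq2 hnd _ fun k hk => (hP₁ g).1 hg k ?_
  have hkP : k ∈ P₁ := (hP₁ k).2 fun h hh => by
    rw [metricForm_comm]
    exact hk h (Subgroup.mem_sup_left hh)
  have hkL : k ∈ L₁ ⊔ L₂ := by
    refine mem_of_forall_orthogonal hq2 hnd _ fun x hx => ?_
    rw [metricForm_comm]
    refine hk x (Subgroup.mem_sup_right ⟨(hP₁ x).2 fun h hh => ?_, (hP₂ x).2 fun h hh => ?_⟩) <;>
      rw [metricForm_comm]
    exacts [hx h (Subgroup.mem_sup_left hh), hx h (Subgroup.mem_sup_right hh)]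
  obtain ⟨a, ha, b, hb, rfl⟩ := Subgroup.mem_sup.1 hkL
  have haP : a ∈ P₁ := (hP₁ a).2 fun h hh => by
    simp [metricForm, hiso₁ _ ha, hiso₁ _ hh, hiso₁ _ (mul_mem ha hh)]
  have hbP : b ∈ P₁ := (Subgroup.mul_mem_cancel_left P₁ haP).1 hkP
  exact mul_mem ha
    (mem_of_maximal_isotropic hq1 hq2 hiso₁ hmax₁ ((hP₁ b).1 hbP) (hiso₂ b hb))

end MetricGroup

/-- If `P ≤ L ⊔ X` and `X ≤ P`, then `X` surjects onto `P ⧸ L`. -/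
theorem Subgroup.mk'_comp_inclusion_surjective {G : Type*} [CommGroup G] {L P X : Subgroup G}
    (hXP : X ≤ P) (hP : P ≤ L ⊔ X) :
    Function.Surjective
      ((QuotientGroup.mk' (L.subgroupOf P)).comp (Subgroup.inclusion hXP)) := by
  intro y
  obtain ⟨⟨p, hp⟩, rfl⟩ := QuotientGroup.mk_surjective y
  obtain ⟨l, hl, x, hx, rfl⟩ := Subgroup.mem_sup.1 (hP hp)
  refine ⟨⟨x, hx⟩, QuotientGroup.eq.2 ?_⟩
  simpa [Subgroup.mem_subgroupOf, mul_comm l x] using hl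

/-- Let `(G,q)` be a nondegenerate metric group and `L₁`, `L₂` two
maximal isotropic subgroups, with orthogonal complements `P₁`, `P₂` and induced
quadratic forms `q̄₁`, `q̄₂` on `P₁/L₁`, `P₂/L₂`. Then there is a group isomorphism
`φ : P₁/L₁ ≃* P₂/L₂` with `q̄₂ ∘ φ = q̄₁`, i.e. the two metric groups are
isomorphic. -/
theorem maximal_isotropic_quotients_isomorphic
    {G : Type*} [CommGroup G] [Fintype G] (q : G → ℂˣ)
    (hq1 : ∀ g : G, q g⁻¹ = q g)
    (hq2 : ∀ g₁ g₂ h : G, metricForm q (g₁ * g₂) h = metricForm q g₁ h * metricForm q g₂ h)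
    (hnd : ∀ g : G, (∀ h : G, metricForm q g h = 1) → g = 1)
    (L₁ L₂ P₁ P₂ : Subgroup G)
    (hiso₁ : ∀ h ∈ L₁, q h = 1) (hiso₂ : ∀ h ∈ L₂, q h = 1)
    (hmax₁ : ∀ L : Subgroup G, (∀ h ∈ L, q h = 1) → L₁ ≤ L → L = L₁)
    (hmax₂ : ∀ L : Subgroup G, (∀ h ∈ L, q h = 1) → L₂ ≤ L → L = L₂)
    (hP₁ : (P₁ : Set G) = {g : G | ∀ h ∈ L₁, metricForm q g h = 1})
    (hP₂ : (P₂ : Set G) = {g : G | ∀ h ∈ L₂, metricForm q g h = 1})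
    (qbar₁ : ↥P₁ ⧸ L₁.subgroupOf P₁ → ℂˣ)
    (hqbar₁ : ∀ g : ↥P₁, qbar₁ (QuotientGroup.mk g) = q (g : G))
    (qbar₂ : ↥P₂ ⧸ L₂.subgroupOf P₂ → ℂˣ)
    (hqbar₂ : ∀ g : ↥P₂, qbar₂ (QuotientGroup.mk g) = q (g : G)) :
    ∃ φ : (↥P₁ ⧸ L₁.subgroupOf P₁) ≃* (↥P₂ ⧸ L₂.subgroupOf P₂),
      ∀ x, qbar₂ (φ x) = qbar₁ x := by
  have hP₁' (g : G) : g ∈ P₁ ↔ ∀ h ∈ L₁, metricForm q g h = 1 := Set.ext_iff.1 hP₁ g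
  have hP₂' (g : G) : g ∈ P₂ ↔ ∀ h ∈ L₂, metricForm q g h = 1 := Set.ext_iff.1 hP₂ g
  have hle₁ : P₁ ≤ L₁ ⊔ P₁ ⊓ P₂ :=
    orthogonal_le_sup_inf_orthogonal hq1 hq2 hnd hiso₁ hiso₂ hmax₁ hP₁' hP₂'
  have hle₂ : P₂ ≤ L₂ ⊔ P₁ ⊓ P₂ := inf_comm P₁ P₂ ▸
    orthogonal_le_sup_inf_orthogonal hq1 hq2 hnd hiso₂ hiso₁ hmax₂ hP₂' hP₁'
  let f₁ := (QuotientGroup.mk' (L₁.subgroupOf P₁)).comp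
    (Subgroup.inclusion (inf_le_left : P₁ ⊓ P₂ ≤ P₁))
  let f₂ := (QuotientGroup.mk' (L₂.subgroupOf P₂)).comp
    (Subgroup.inclusion (inf_le_right : P₁ ⊓ P₂ ≤ P₂))
  have hf₁ : Function.Surjective f₁ := Subgroup.mk'_comp_inclusion_surjective _ hle₁
  have hf₂ : Function.Surjective f₂ := Subgroup.mk'_comp_inclusion_surjective _ hle₂
  have hker : f₁.ker = f₂.ker := by
    ext ⟨x, hx₁, hx₂⟩
    have h₁ : f₁ ⟨x, hx₁, hx₂⟩ = 1 ↔ x ∈ L₁ := QuotientGroup.eq_one_iff _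
    have h₂ : f₂ ⟨x, hx₁, hx₂⟩ = 1 ↔ x ∈ L₂ := QuotientGroup.eq_one_iff _
    rw [MonoidHom.mem_ker, MonoidHom.mem_ker, h₁, h₂]
    exact ⟨fun h => mem_of_maximal_isotropic hq1 hq2 hiso₂ hmax₂ ((hP₂' x).1 hx₂) (hiso₁ x h),
      fun h => mem_of_maximal_isotropic hq1 hq2 hiso₁ hmax₁ ((hP₁' x).1 hx₁) (hiso₂ x h)⟩
  let e₁ := QuotientGroup.quotientKerEquivOfSurjective f₁ hf₁
  let e₂ := QuotientGroup.quotientKerEquivOfSurjective f₂ hf₂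
  refine ⟨e₁.symm.trans ((QuotientGroup.quotientMulEquivOfEq hker).trans e₂), fun y => ?_⟩
  obtain ⟨x, rfl⟩ := hf₁ y
  have hx : e₁.symm (f₁ x) = QuotientGroup.mk x := e₁.symm_apply_eq.2 rfl
  rw [MulEquiv.trans_apply, hx]
  exact (hqbar₂ _).trans (hqbar₁ (Subgroup.inclusion inf_le_left x)).symm
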